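/- Let $\alpha,\beta$ be real numbers with $1<\alpha<\beta<\alpha+1$, and set $w_j:=1-e^{-j^\beta}$ and $\rho_j:=e^{-j^\alpha}$ for $j\ge1$. Define $g:(0,1)\to(0,\infty)$ by $g(x):=\exp\left(P_h\!\left(\frac{1-x}{1+x}\right)\right)$. Then for every $r\in(0,1)$ the series $\sum_{j\ge1}\frac{(1-w_j)^{1/2}}{j^2}\,\frac{g(r w_j)}{g(w_j)}$ converges to a finite positive number $F(r)$, and $F(r)\to\infty$ as $r\to1^-$. -/

import Mathlib

open Filter MeasureTheory

/-- `t_k := (1 - w_k²)/(1 + w_k²)`. -/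
noncomputable def tseq (w : ℕ → ℝ) (k : ℕ) : ℝ := (1 - w k ^ 2) / (1 + w k ^ 2)

/-- `ε_k := ((1 - w_k)/(1 - w_{k+1})) ρ_k`. -/
noncomputable def epsseq (w ρ : ℕ → ℝ) (k : ℕ) : ℝ := (1 - w k) / (1 - w (k + 1)) * ρ k

/-- `h := ∑_{k≥1} (ε_k/t_k) 1_{[2t_k, 3t_k]}`. -/
noncomputable def hfun (w ρ : ℕ → ℝ) (x : ℝ) : ℝ :=
  ∑' k : ℕ, Set.indicator (Set.Icc (2 * tseq w (k + 1)) (3 * tseq w (k + 1)))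
    (fun _ => epsseq w ρ (k + 1) / tseq w (k + 1)) x

/-- `P_h(y) := (1/π) ∫_ℝ y/(y² + x²) h(x) dx`, the Poisson integral of `h` for the
upper half-plane evaluated at `iy`. -/
noncomputable def Ph (w ρ : ℕ → ℝ) (y : ℝ) : ℝ :=
  (1 / Real.pi) * ∫ x : ℝ, y / (y ^ 2 + x ^ 2) * hfun w ρ x

/-- `w_j := 1 - e^{-j^β}`. -/
noncomputable def wseq (β : ℝ) (j : ℕ) : ℝ := 1 - Real.exp (-(j : ℝ) ^ β)

/-- `ρ_j := e^{-j^α}`. -/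
noncomputable def rhoseq (α : ℝ) (j : ℕ) : ℝ := Real.exp (-(j : ℝ) ^ α)

/-- `g(x) := exp(P_h((1-x)/(1+x)))`, the modulus along the radius `(0,1)` of the outer
function constructed in Lemma 3.3 for the data `w_j = 1 - e^{-j^β}`, `ρ_j = e^{-j^α}`. -/
noncomputable def gfun (α β : ℝ) (x : ℝ) : ℝ :=
  Real.exp (Ph (wseq β) (rhoseq α) ((1 - x) / (1 + x)))

lemma hasSum_integral_mul_tsum_indicator {t c : ℕ → ℝ} (ht : ∀ k, 0 < t k) (hc : ∀ k, 0 ≤ c k)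
    (hs : Summable c) {K : ℝ → ℝ} (hK : Continuous K) {M : ℝ} (hM : ∀ x, ‖K x‖ ≤ M) :
    HasSum (fun k => c k / t k * ∫ x in Set.Icc (2 * t k) (3 * t k), K x)
      (∫ x, K x * ∑' k, Set.indicator (Set.Icc (2 * t k) (3 * t k)) (fun _ => c k / t k) x) := by
  have hF : ∀ k, (fun x => K x * Set.indicator (Set.Icc (2 * t k) (3 * t k))
      (fun _ => c k / t k) x) =
      Set.indicator (Set.Icc (2 * t k) (3 * t k)) (fun x => c k / t k * K x) := by
    intro k
    ext x
    by_cases hx : x ∈ Set.Icc (2 * t k) (3 * t k) 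
    · simp only [Set.indicator_of_mem hx]
      ring
    · simp only [Set.indicator_of_notMem hx, mul_zero]
  have hint : ∀ k, IntegrableOn (fun x => c k / t k * K x) (Set.Icc (2 * t k) (3 * t k)) :=
    fun k => (hK.const_mul _).continuousOn.integrableOn_Icc
  have key := hasSum_integral_of_summable_integral_norm (μ := volume)
    (F := fun k x => K x * Set.indicator (Set.Icc (2 * t k) (3 * t k)) (fun _ => c k / t k) x)
    (fun k => by
      rw [hF k]
      exact (hint k).integrable_indicator measurableSet_Icc)
    (by
      refine Summable.of_nonneg_of_le (fun k => integral_nonneg fun x => norm_nonneg _) ?_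
        (hs.mul_left M)
      intro k
      have h1 : (fun x => ‖K x * Set.indicator (Set.Icc (2 * t k) (3 * t k))
          (fun _ => c k / t k) x‖) =
          Set.indicator (Set.Icc (2 * t k) (3 * t k)) (fun x => ‖c k / t k * K x‖) := by
        ext x
        rw [congrFun (hF k) x, norm_indicator_eq_indicator_norm]
      simp only [h1]
      rw [integral_indicator measurableSet_Icc]
      calc ∫ x in Set.Icc (2 * t k) (3 * t k), ‖c k / t k * K x‖
          ≤ ∫ _ in Set.Icc (2 * t k) (3 * t k), c k / t k * M := by
            refine setIntegral_mono_on (hint k).norm (integrableOn_const (by simp))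
              measurableSet_Icc ?_
            intro x _
            rw [norm_mul, Real.norm_of_nonneg (div_nonneg (hc k) (ht k).le)]
            exact mul_le_mul_of_nonneg_left (hM x) (div_nonneg (hc k) (ht k).le)
        _ = M * c k := by
            have := ht k
            rw [setIntegral_const, Real.volume_real_Icc_of_le (by linarith), smul_eq_mul]
            field_simp
            ring)
  simp only [tsum_mul_left] at key
  have hk : ∀ k, ∫ x, K x * Set.indicator (Set.Icc (2 * t k) (3 * t k)) (fun _ => c k / t k) x =
      c k / t k * ∫ x in Set.Icc (2 * t k) (3 * t k), K x := fun k => by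
    rw [hF k, integral_indicator measurableSet_Icc, integral_const_mul]
  simpa only [hk] using key

lemma continuous_poissonKernel {y : ℝ} (hy : 0 < y) :
    Continuous fun x : ℝ => y / (y ^ 2 + x ^ 2) :=
  continuous_const.div (by fun_prop) fun x => by positivity

lemma poissonKernel_le {y : ℝ} (hy : 0 < y) (x : ℝ) : y / (y ^ 2 + x ^ 2) ≤ 1 / y := by
  rw [div_le_div_iff₀ (by positivity) hy]
  nlinarith [sq_nonneg x]

lemma hasSum_Ph {w ρ : ℕ → ℝ} (ht : ∀ k, 0 < tseq w (k + 1)) (he : ∀ k, 0 ≤ epsseq w ρ (k + 1))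
    (hs : Summable fun k => epsseq w ρ (k + 1)) {y : ℝ} (hy : 0 < y) :
    HasSum (fun k => 1 / Real.pi * (epsseq w ρ (k + 1) / tseq w (k + 1) *
      ∫ x in Set.Icc (2 * tseq w (k + 1)) (3 * tseq w (k + 1)), y / (y ^ 2 + x ^ 2)))
      (Ph w ρ y) := by
  refine HasSum.mul_left _ ?_
  refine hasSum_integral_mul_tsum_indicator ht he hs (continuous_poissonKernel hy) (M := 1 / y) ?_
  intro x
  rw [Real.norm_of_nonneg (by positivity)]
  exact poissonKernel_le hy x

lemma Ph_nonneg {w ρ : ℕ → ℝ} (ht : ∀ k, 0 < tseq w (k + 1))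
    (he : ∀ k, 0 ≤ epsseq w ρ (k + 1)) {y : ℝ} (hy : 0 < y) : 0 ≤ Ph w ρ y := by
  refine mul_nonneg (by positivity) (integral_nonneg fun x => mul_nonneg (by positivity) ?_)
  exact tsum_nonneg fun k => Set.indicator_nonneg (fun _ _ => div_nonneg (he k) (ht k).le) _

lemma Ph_le {w ρ : ℕ → ℝ} (ht : ∀ k, 0 < tseq w (k + 1)) (he : ∀ k, 0 ≤ epsseq w ρ (k + 1))
    (hs : Summable fun k => epsseq w ρ (k + 1)) {y₀ y : ℝ} (hy₀ : 0 < y₀) (hy : y₀ ≤ y) :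
    Ph w ρ y ≤ 1 / Real.pi * (1 / y₀ * ∑' k, epsseq w ρ (k + 1)) := by
  have hy' : 0 < y := hy₀.trans_le hy
  refine hasSum_le ?_ (hasSum_Ph ht he hs hy') ((hs.hasSum.mul_left _).mul_left _)
  intro k
  refine mul_le_mul_of_nonneg_left ?_ (by positivity)
  have htk := ht k
  have hint : ∫ x in Set.Icc (2 * tseq w (k + 1)) (3 * tseq w (k + 1)), y / (y ^ 2 + x ^ 2) ≤
      tseq w (k + 1) * (1 / y₀) := by
    calc _ ≤ ∫ _ in Set.Icc (2 * tseq w (k + 1)) (3 * tseq w (k + 1)), 1 / y₀ := by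
          refine setIntegral_mono_on (continuous_poissonKernel hy').continuousOn.integrableOn_Icc
            (integrableOn_const (by simp)) measurableSet_Icc fun x _ => ?_
          exact (poissonKernel_le hy' x).trans (one_div_le_one_div_of_le hy₀ hy)
      _ = _ := by
          rw [setIntegral_const, Real.volume_real_Icc_of_le (by linarith), smul_eq_mul]
          ring
  calc _ ≤ epsseq w ρ (k + 1) / tseq w (k + 1) * (tseq w (k + 1) * (1 / y₀)) :=
        mul_le_mul_of_nonneg_left hint (div_nonneg (he k) htk.le)
    _ = _ := by field_simp

lemma poissonKernel_sub {y z : ℝ} (hy : 0 < y) (hz : 0 < z) (x : ℝ) :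
    z / (z ^ 2 + x ^ 2) - y / (y ^ 2 + x ^ 2) =
      (z - y) * ((x ^ 2 - y * z) / ((z ^ 2 + x ^ 2) * (y ^ 2 + x ^ 2))) := by
  field_simp
  ring

lemma le_integral_poissonKernel_sub {y z t c e : ℝ} (hy : 0 < y) (hz : 0 < z) (ht : 0 < t)
    (he : 0 ≤ e)
    (h : ∀ x ∈ Set.Icc (2 * t) (3 * t), c ≤ z / (z ^ 2 + x ^ 2) - y / (y ^ 2 + x ^ 2)) :
    1 / Real.pi * (e * c) ≤
      1 / Real.pi * (e / t * ∫ x in Set.Icc (2 * t) (3 * t), z / (z ^ 2 + x ^ 2)) -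
      1 / Real.pi * (e / t * ∫ x in Set.Icc (2 * t) (3 * t), y / (y ^ 2 + x ^ 2)) := by
  have iy : IntegrableOn (fun x => y / (y ^ 2 + x ^ 2)) (Set.Icc (2 * t) (3 * t)) :=
    (continuous_poissonKernel hy).continuousOn.integrableOn_Icc
  have iz : IntegrableOn (fun x => z / (z ^ 2 + x ^ 2)) (Set.Icc (2 * t) (3 * t)) :=
    (continuous_poissonKernel hz).continuousOn.integrableOn_Icc
  rw [← mul_sub, ← mul_sub, ← integral_sub iz iy]
  refine mul_le_mul_of_nonneg_left ?_ (by positivity)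
  have : t * c ≤ ∫ x in Set.Icc (2 * t) (3 * t),
      (z / (z ^ 2 + x ^ 2) - y / (y ^ 2 + x ^ 2)) := by
    calc t * c = ∫ _ in Set.Icc (2 * t) (3 * t), c := by
          rw [setIntegral_const, Real.volume_real_Icc_of_le (by linarith), smul_eq_mul]
          ring
      _ ≤ _ := setIntegral_mono_on (integrableOn_const (by simp)) (iz.sub iy)
          measurableSet_Icc h
  calc e * c = e / t * (t * c) := by field_simp
    _ ≤ _ := mul_le_mul_of_nonneg_left this (div_nonneg he ht.le)

lemma poissonKernel_sub_nonneg {y z t x : ℝ} (hy : 0 < y) (hyz : y ≤ z) (hz : z ≤ t)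
    (hx : 2 * t ≤ x) : 0 ≤ z / (z ^ 2 + x ^ 2) - y / (y ^ 2 + x ^ 2) := by
  have hz0 : 0 < z := hy.trans_le hyz
  rw [poissonKernel_sub hy hz0]
  refine mul_nonneg (by linarith) (div_nonneg ?_ (by positivity))
  nlinarith

lemma le_poissonKernel_sub {y z t x : ℝ} (hy : 0 < y) (hyz : y ≤ z) (hz : z ≤ t)
    (hx : x ∈ Set.Icc (2 * t) (3 * t)) :
    (z - y) / t ^ 2 * (3 / 100) ≤ z / (z ^ 2 + x ^ 2) - y / (y ^ 2 + x ^ 2) := by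
  obtain ⟨hx1, hx2⟩ := hx
  have hz0 : 0 < z := hy.trans_le hyz
  have ht : 0 < t := hz0.trans_le hz
  have hx3 : x ^ 2 ≤ 9 * t ^ 2 := by nlinarith
  have hx4 : 4 * t ^ 2 ≤ x ^ 2 := by nlinarith
  have hz2 : z ^ 2 ≤ t ^ 2 := by nlinarith
  have hy2 : y ^ 2 ≤ t ^ 2 := by nlinarith
  have hyz2 : y * z ≤ t ^ 2 := by nlinarith
  rw [poissonKernel_sub hy hz0, div_mul_eq_mul_div, mul_div_assoc]
  refine mul_le_mul_of_nonneg_left ?_ (by linarith)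
  calc 3 / 100 / t ^ 2 = (3 * t ^ 2) / ((10 * t ^ 2) * (10 * t ^ 2)) := by field_simp; norm_num
    _ ≤ _ := div_le_div₀ (by nlinarith) (by linarith) (by positivity)
        (mul_le_mul (by linarith) (by linarith) (by positivity) (by positivity))

lemma neg_le_poissonKernel_sub {y z t : ℝ} (ht : 0 < t) (hy : t / 4 ≤ y) (hyz : y ≤ z) (x : ℝ) :
    (z - y) / t ^ 2 * (-16) ≤ z / (z ^ 2 + x ^ 2) - y / (y ^ 2 + x ^ 2) := by
  have hy0 : 0 < y := by linarith
  have hz0 : 0 < z := by linarith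
  rw [poissonKernel_sub hy0 hz0, div_mul_eq_mul_div, mul_div_assoc]
  refine mul_le_mul_of_nonneg_left ?_ (by linarith)
  have hyz2 : t ^ 2 ≤ 16 * (y * z) := by nlinarith
  calc -16 / t ^ 2 ≤ -1 / (y * z) := by
        rw [div_le_div_iff₀ (by positivity) (by positivity)]
        linarith
    _ ≤ _ := by
        rw [div_le_div_iff₀ (by positivity) (by positivity)]
        have h1 : 0 ≤ x ^ 2 * (x ^ 2 + y ^ 2 + z ^ 2 + y * z) := by positivity
        nlinarith

/-- Passing from height `y` to a slightly larger height `z ≤ t_n` increases `P_h` by an amount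
governed by `ε_n`, up to the tail `∑_{k>n} ε_k`. -/
lemma le_Ph_sub {w ρ : ℕ → ℝ} (ht : ∀ k, 0 < tseq w (k + 1)) (he : ∀ k, 0 ≤ epsseq w ρ (k + 1))
    (hs : Summable fun k => epsseq w ρ (k + 1)) (n : ℕ)
    (hanti : ∀ k ≤ n, tseq w (n + 1) ≤ tseq w (k + 1)) {y z : ℝ}
    (hy : tseq w (n + 1) / 4 ≤ y) (hyz : y ≤ z) (hz : z ≤ tseq w (n + 1)) :
    1 / Real.pi * ((z - y) / tseq w (n + 1) ^ 2 *
      (3 / 100 * epsseq w ρ (n + 1) - 16 * ∑' k, epsseq w ρ (k + (n + 1) + 1))) ≤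
      Ph w ρ z - Ph w ρ y := by
  set t := tseq w (n + 1) with ht_def
  have htn : 0 < t := ht n
  have hy0 : 0 < y := by linarith
  have hz0 : 0 < z := by linarith
  have hD := (hasSum_Ph ht he hs hz0).sub (hasSum_Ph ht he hs hy0)
  rw [← hD.tsum_eq, ← hD.summable.sum_add_tsum_nat_add (n + 1)]
  have h1 := Finset.single_le_sum (s := Finset.range (n + 1)) (a := n) (f := fun k =>
      1 / Real.pi * (epsseq w ρ (k + 1) / tseq w (k + 1) *
        ∫ x in Set.Icc (2 * tseq w (k + 1)) (3 * tseq w (k + 1)), z / (z ^ 2 + x ^ 2)) -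
      1 / Real.pi * (epsseq w ρ (k + 1) / tseq w (k + 1) *
        ∫ x in Set.Icc (2 * tseq w (k + 1)) (3 * tseq w (k + 1)), y / (y ^ 2 + x ^ 2)))
    (fun k hk => by
      have hk' : k ≤ n := by simpa [Nat.lt_succ_iff] using hk
      simpa using le_integral_poissonKernel_sub hy0 hz0 (ht k) (he k) (c := 0) fun x hx =>
        poissonKernel_sub_nonneg hy0 hyz (hz.trans (hanti k hk')) hx.1)
    (by simp)
  have h2 := le_integral_poissonKernel_sub hy0 hz0 (ht n) (he n) fun x hx =>
    le_poissonKernel_sub hy0 hyz hz hx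
  have h3 := Summable.tsum_le_tsum (fun k => le_integral_poissonKernel_sub hy0 hz0
      (ht (k + (n + 1))) (he (k + (n + 1))) fun x _ =>
      neg_le_poissonKernel_sub htn hy hyz x)
    ((((summable_nat_add_iff (n + 1)).2 hs).mul_right _).mul_left _)
    ((summable_nat_add_iff (n + 1)).2 hD.summable)
  rw [tsum_mul_left, tsum_mul_right] at h3
  refine le_trans (le_of_eq ?_) (add_le_add (h2.trans h1) h3)
  ring

lemma rpow_add_mul_rpow_sub_one_le {a d p : ℝ} (ha : 0 < a) (hd : 0 ≤ a + d) (hp : 1 ≤ p) :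
    a ^ p + p * a ^ (p - 1) * d ≤ (a + d) ^ p := by
  have h1 : -1 ≤ d / a := by
    rw [le_div_iff₀ ha]
    linarith
  have h2 := one_add_mul_self_le_rpow_one_add h1 hp
  have h3 : a + d = a * (1 + d / a) := by field_simp
  rw [h3, Real.mul_rpow ha.le (by linarith), Real.rpow_sub_one ha.ne']
  calc a ^ p + p * (a ^ p / a) * d = a ^ p * (1 + p * (d / a)) := by ring
    _ ≤ _ := mul_le_mul_of_nonneg_left h2 (by positivity)

lemma add_two_rpow_sub_rpow_le {x p : ℝ} (hx : 1 ≤ x) (hp : 0 ≤ p) :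
    (x + 2) ^ p - x ^ p ≤ 2 * p * Real.exp (2 * p) * x ^ (p - 1) := by
  have hx0 : 0 < x := by linarith
  have h1 : (1 + 2 / x) ^ p ≤ Real.exp (2 * p / x) := by
    calc (1 + 2 / x) ^ p ≤ Real.exp (2 / x) ^ p := by
          refine Real.rpow_le_rpow (by positivity) ?_ hp
          linarith [Real.add_one_le_exp (2 / x)]
      _ = _ := by
          rw [← Real.exp_mul]
          ring_nf
  have h2 : Real.exp (2 * p / x) - 1 ≤ 2 * p / x * Real.exp (2 * p) := by
    have h3 := Real.add_one_le_exp (-(2 * p / x))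
    have h4 : Real.exp (-(2 * p / x)) * Real.exp (2 * p / x) = 1 := by
      rw [← Real.exp_add]
      simp
    have h5 : Real.exp (2 * p / x) ≤ Real.exp (2 * p) :=
      Real.exp_le_exp.2 (div_le_self (by positivity) hx)
    have h6 : 0 ≤ 2 * p / x := by positivity
    nlinarith [Real.exp_pos (2 * p / x)]
  have h3 : x + 2 = x * (1 + 2 / x) := by field_simp
  rw [h3, Real.mul_rpow hx0.le (by positivity), Real.rpow_sub_one hx0.ne']
  calc x ^ p * (1 + 2 / x) ^ p - x ^ p = x ^ p * ((1 + 2 / x) ^ p - 1) := by ring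
    _ ≤ x ^ p * (2 * p / x * Real.exp (2 * p)) :=
        mul_le_mul_of_nonneg_left (by linarith) (by positivity)
    _ = _ := by ring

lemma tendsto_second_difference_rpow {α β : ℝ} (hα : 1 < α) (hαβ : α < β) (hβ : β < α + 1) :
    Tendsto (fun x : ℝ => ((x + 2) ^ β - (x + 1) ^ β - (x + 1) ^ α) -
      ((x + 1) ^ β - x ^ β - x ^ α)) atTop atBot := by
  set C := β * (2 * (β - 1) * Real.exp (2 * (β - 1))) with hC
  have hlim : Tendsto (fun x : ℝ => C * x ^ (-(α + 1 - β))) atTop (nhds 0) := by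
    simpa using (tendsto_rpow_neg_atTop (by linarith : 0 < α + 1 - β)).const_mul C
  have hpow : Tendsto (fun x : ℝ => -((α - 1) * x ^ (α - 1))) atTop atBot :=
    tendsto_neg_atTop_atBot.comp
      ((tendsto_rpow_atTop (by linarith : 0 < α - 1)).const_mul_atTop (by linarith))
  refine tendsto_atBot_mono' atTop ?_ hpow
  filter_upwards [hlim.eventually_le_const one_pos, eventually_ge_atTop 1] with x hx1 hx
  have hx0 : 0 < x := by linarith
  have e1 := rpow_add_mul_rpow_sub_one_le (a := x + 2) (d := -1) (p := β) (by linarith)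
    (by linarith) (by linarith)
  have e2 := rpow_add_mul_rpow_sub_one_le (a := x) (d := 1) (p := β) hx0
    (by linarith) (by linarith)
  have e3 := rpow_add_mul_rpow_sub_one_le (a := x) (d := 1) (p := α) hx0
    (by linarith) (by linarith)
  have e4 := mul_le_mul_of_nonneg_left (add_two_rpow_sub_rpow_le hx (by linarith : 0 ≤ β - 1))
    (by linarith : 0 ≤ β)
  have e5 : x ^ (β - 1 - 1) = x ^ (α - 1) * x ^ (-(α + 1 - β)) := by
    rw [← Real.rpow_add hx0]
    ring_nf
  have e6 := mul_le_mul_of_nonneg_left hx1 (by positivity : 0 ≤ x ^ (α - 1))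
  have e7 : x + 2 + -1 = x + 1 := by ring
  rw [e7] at e1
  rw [e5] at e4
  have e8 : β * (2 * (β - 1) * Real.exp (2 * (β - 1)) * (x ^ (α - 1) * x ^ (-(α + 1 - β)))) =
      x ^ (α - 1) * (C * x ^ (-(α + 1 - β))) := by
    rw [hC]
    ring
  rw [e8] at e4
  nlinarith

lemma tsum_nat_add_succ_le {u : ℕ → ℝ} {q : ℝ} (hq0 : 0 ≤ q) (hq1 : q < 1) {n : ℕ}
    (h : ∀ k ≥ n, u (k + 1) ≤ q * u k) (hs : Summable u) :
    ∑' k, u (k + (n + 1)) ≤ q / (1 - q) * u n := by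
  have hle : ∀ k, u (k + (n + 1)) ≤ q ^ k * (q * u n) := by
    intro k
    induction k with
    | zero => simpa using h n le_rfl
    | succ k ih =>
      have := h (k + (n + 1)) (by omega)
      rw [show k + 1 + (n + 1) = k + (n + 1) + 1 by ring, pow_succ']
      calc _ ≤ q * u (k + (n + 1)) := this
        _ ≤ q * (q ^ k * (q * u n)) := mul_le_mul_of_nonneg_left ih hq0
        _ = _ := by ring
  calc _ ≤ ∑' k, q ^ k * (q * u n) :=
        Summable.tsum_le_tsum hle ((summable_nat_add_iff (n + 1)).2 hs)
          ((summable_geometric_of_lt_one hq0 hq1).mul_right _)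
    _ = _ := by
        rw [tsum_mul_right, tsum_geometric_of_lt_one hq0 hq1]
        ring

lemma epsseq_wseq_rhoseq (α β : ℝ) (k : ℕ) :
    epsseq (wseq β) (rhoseq α) k =
      Real.exp (((k : ℝ) + 1) ^ β - (k : ℝ) ^ β - (k : ℝ) ^ α) := by
  simp only [epsseq, wseq, rhoseq, sub_sub_cancel, Nat.cast_add, Nat.cast_one]
  rw [← Real.exp_sub, ← Real.exp_add]
  ring_nf

lemma eventually_epsseq_succ_le {α β : ℝ} (hα : 1 < α) (hαβ : α < β) (hβ : β < α + 1) {q : ℝ}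
    (hq : 0 < q) : ∀ᶠ k : ℕ in atTop, epsseq (wseq β) (rhoseq α) (k + 1 + 1) ≤
      q * epsseq (wseq β) (rhoseq α) (k + 1) := by
  have hcast : Tendsto (fun k : ℕ => (k : ℝ) + 1) atTop atTop :=
    tendsto_atTop_add_const_right _ _ tendsto_natCast_atTop_atTop
  filter_upwards [((tendsto_second_difference_rpow hα hαβ hβ).comp hcast).eventually_le_atBot
    (Real.log q)] with k hk
  simp only [Function.comp] at hk
  rw [epsseq_wseq_rhoseq, epsseq_wseq_rhoseq]
  calc _ ≤ Real.exp (Real.log q + (((k : ℝ) + 1 + 1) ^ β - ((k : ℝ) + 1) ^ β -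
        ((k : ℝ) + 1) ^ α)) := by
        refine Real.exp_le_exp.2 ?_
        push_cast
        rw [show (k : ℝ) + 1 + 2 = k + 1 + 1 + 1 by ring] at hk
        linarith
    _ = _ := by
        rw [Real.exp_add, Real.exp_log hq]
        push_cast
        rfl

lemma summable_epsseq {α β : ℝ} (hα : 1 < α) (hαβ : α < β) (hβ : β < α + 1) :
    Summable fun k => epsseq (wseq β) (rhoseq α) (k + 1) := by
  refine summable_of_ratio_norm_eventually_le (r := 1 / 2) (by norm_num) ?_
  filter_upwards [eventually_epsseq_succ_le hα hαβ hβ (by norm_num : (0 : ℝ) < 1 / 2)] with k hk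
  rw [epsseq_wseq_rhoseq, epsseq_wseq_rhoseq] at *
  simpa only [Real.norm_eq_abs, Real.abs_exp] using hk

lemma wseq_lt_one (β : ℝ) (k : ℕ) : wseq β k < 1 := by
  have := Real.exp_pos (-(k : ℝ) ^ β)
  simp only [wseq]
  linarith

lemma half_le_wseq {β : ℝ} (hβ : 0 ≤ β) (k : ℕ) : 1 / 2 ≤ wseq β (k + 1) := by
  have h1 : (1 : ℝ) ≤ ((k + 1 : ℕ) : ℝ) ^ β := Real.one_le_rpow (by simp) hβ
  have h2 : Real.exp (-((k + 1 : ℕ) : ℝ) ^ β) ≤ Real.exp (-1) := Real.exp_le_exp.2 (by linarith)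
  have h3 : Real.exp (-1) ≤ 1 / 2 := by
    rw [Real.exp_neg, one_div]
    exact inv_anti₀ (by norm_num) (by linarith [Real.add_one_le_exp 1])
  simp only [wseq]
  linarith

lemma monotone_wseq {β : ℝ} (hβ : 0 ≤ β) : Monotone (wseq β) := by
  intro j k hjk
  have : (j : ℝ) ^ β ≤ (k : ℝ) ^ β := Real.rpow_le_rpow (by positivity) (by exact_mod_cast hjk) hβ
  have := Real.exp_le_exp.2 (neg_le_neg this)
  simp only [wseq]
  linarith

lemma tendsto_wseq {β : ℝ} (hβ : 0 < β) : Tendsto (wseq β) atTop (nhds 1) := by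
  have h : Tendsto (fun k : ℕ => Real.exp (-(k : ℝ) ^ β)) atTop (nhds 0) :=
    Real.tendsto_exp_neg_atTop_nhds_zero.comp
      ((tendsto_rpow_atTop hβ).comp tendsto_natCast_atTop_atTop)
  have h1 := h.const_sub 1
  rw [sub_zero] at h1
  exact h1

lemma tseq_pos {w : ℕ → ℝ} {k : ℕ} (h0 : 0 ≤ w k) (h1 : w k < 1) : 0 < tseq w k :=
  div_pos (by nlinarith) (by positivity)

lemma tseq_le_tseq {w : ℕ → ℝ} {j k : ℕ} (h0 : 0 ≤ w j) (h : w j ≤ w k) :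
    tseq w k ≤ tseq w j := by
  rw [tseq, tseq, div_le_div_iff₀ (by positivity) (by positivity)]
  nlinarith

lemma epsseq_nonneg (α β : ℝ) (k : ℕ) : 0 ≤ epsseq (wseq β) (rhoseq α) k := by
  rw [epsseq_wseq_rhoseq]
  positivity

/-- For `w_n ≤ r ≤ w_{n+1}`, the Poisson integral gains at least a multiple of `ρ_n / (1 - w_n)`
when passing from `w_n` to `r w_n`. -/
lemma le_Ph_sub_of_mem_Icc {w ρ : ℕ → ℝ} (hw : ∀ k, 1 / 2 ≤ w (k + 1)) (hw1 : ∀ k, w k < 1)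
    (hmono : Monotone w) (he : ∀ k, 0 ≤ epsseq w ρ (k + 1))
    (hs : Summable fun k => epsseq w ρ (k + 1)) {n : ℕ}
    (htail : 16 * ∑' k, epsseq w ρ (k + (n + 1) + 1) ≤ 1 / 100 * epsseq w ρ (n + 1))
    {r : ℝ} (hr : r ∈ Set.Icc (w (n + 1)) (w (n + 2))) :
    ρ (n + 1) / (1 - w (n + 1)) / 4000 ≤
      Ph w ρ ((1 - r * w (n + 1)) / (1 + r * w (n + 1))) -
      Ph w ρ ((1 - w (n + 1)) / (1 + w (n + 1))) := by
  have ht : ∀ k, 0 < tseq w (k + 1) := fun k => tseq_pos (by linarith [hw k]) (hw1 _)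
  have hen := he n
  obtain ⟨hr1, hr2⟩ := hr
  have hv1 := hw1 (n + 2)
  have hw2 := hw n
  have hwn1 := hw1 (n + 1)
  have htn := ht n
  have hteq : tseq w (n + 1) = (1 - w (n + 1) ^ 2) / (1 + w (n + 1) ^ 2) := rfl
  have heeq : epsseq w ρ (n + 1) = (1 - w (n + 1)) / (1 - w (n + 2)) * ρ (n + 1) := rfl
  set u := w (n + 1) with hu
  set v := w (n + 2) with hv
  set t := tseq w (n + 1) with ht_def
  set e := epsseq w ρ (n + 1) with he_def
  have hr0 : 0 < r := by linarith
  have hru : 0 < r * u := mul_pos hr0 (by linarith)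
  have ht2 : t ≤ 2 * (1 - u) := by
    rw [hteq, div_le_iff₀ (by positivity)]
    nlinarith [sq_nonneg (u - 1 / 2), mul_nonneg (sub_nonneg.2 hwn1.le) (sq_nonneg (u - 1 / 4))]
  have hy : t / 4 ≤ (1 - u) / (1 + u) := by
    rw [le_div_iff₀ (by linarith)]
    nlinarith
  have hδ : (1 - v) / 4 ≤ (1 - r * u) / (1 + r * u) - (1 - u) / (1 + u) := by
    rw [div_sub_div _ _ (by positivity) (by positivity), le_div_iff₀ (by positivity)]
    have h1 : (1 + r * u) * (1 + u) ≤ 4 := by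
      have : r * u ≤ 1 := by nlinarith
      nlinarith
    have h2 : (1 - v) / 4 * ((1 + r * u) * (1 + u)) ≤ (1 - v) / 4 * 4 :=
      mul_le_mul_of_nonneg_left h1 (by linarith)
    nlinarith
  have hz : (1 - r * u) / (1 + r * u) ≤ t := by
    rw [hteq, div_le_div_iff₀ (by positivity) (by positivity)]
    nlinarith
  have key := le_Ph_sub ht he hs n
    (fun k hk => tseq_le_tseq (by linarith [hw k]) (hmono (by omega))) hy (by linarith) hz
  refine le_trans ?_ key
  have hpi : 1 / 4 ≤ 1 / Real.pi := one_div_le_one_div_of_le Real.pi_pos Real.pi_le_four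
  have hρ : ρ (n + 1) = e * (1 - v) / (1 - u) := by
    have h1 : 1 - u ≠ 0 := by linarith
    have h2 : 1 - v ≠ 0 := by linarith
    rw [heeq]
    field_simp
  have hu0 : 0 < 1 - u := by linarith
  have hv0 : 0 < 1 - v := by linarith
  calc ρ (n + 1) / (1 - u) / 4000 = e * (1 - v) / (1 - u) / (1 - u) / 4000 := by rw [hρ]
    _ ≤ e * (1 - v) / (1 - u) / (1 - u) / 3200 := by gcongr; norm_num
    _ = 1 / 4 * ((1 - v) / 4 / (2 * (1 - u)) ^ 2 * (1 / 50 * e)) := by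
        field_simp
        ring
    _ ≤ _ := by
        refine mul_le_mul hpi ?_ (by positivity) (by positivity)
        refine mul_le_mul ?_ (by linarith) (by positivity) ?_
        · exact div_le_div₀ (by linarith) hδ (by positivity)
            (pow_le_pow_left₀ htn.le ht2 2)
        · exact div_nonneg (by linarith) (by positivity)

lemma tendsto_exp_exp_rpow_sub_rpow {α β : ℝ} (hα : 1 < α) (hαβ : α < β) :
    Tendsto (fun x : ℝ => Real.exp (-(x ^ β) / 2) / x ^ 2 *
      Real.exp (Real.exp (x ^ β - x ^ α) / 4000)) atTop atTop := by
  refine tendsto_atTop_mono' atTop ?_ Real.tendsto_exp_atTop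
  filter_upwards [eventually_ge_atTop 1,
    (tendsto_rpow_atTop (by linarith : 0 < β - α)).eventually_ge_atTop 2,
    (isLittleO_rpow_exp_atTop β).bound (by norm_num : (0 : ℝ) < 1 / 16000)] with x hx h2 h3
  have hx0 : 0 < x := by linarith
  have h4 : x ≤ x ^ α := Real.self_le_rpow_of_one_le hx hα.le
  have h5 : x ≤ x ^ β := Real.self_le_rpow_of_one_le hx (by linarith)
  have h6 : x ^ β = x ^ α * x ^ (β - α) := by
    rw [← Real.rpow_add hx0]
    ring_nf
  have h7 : x ≤ x ^ β - x ^ α := by nlinarith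
  have h8 := Real.exp_le_exp.2 h7
  rw [Real.norm_of_nonneg (by positivity), Real.norm_of_nonneg (by positivity)] at h3
  have h9 : x ^ 2 ≤ Real.exp (2 * x) := by
    rw [two_mul, Real.exp_add, sq]
    have := Real.add_one_le_exp x
    exact mul_le_mul (by linarith) (by linarith) hx0.le (by positivity)
  calc Real.exp x ≤ Real.exp (-(x ^ β) / 2 - 2 * x + 4 * x ^ β) :=
        Real.exp_le_exp.2 (by linarith)
    _ = Real.exp (-(x ^ β) / 2) / Real.exp (2 * x) * Real.exp (4 * x ^ β) := by
        rw [Real.exp_add, Real.exp_sub]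
    _ ≤ _ := by
        gcongr
        linarith

/-- Quantitative core of Theorem 3.1: with `1 < α < β < α + 1`, for each `r ∈ (0,1)` the
series `F(r) = ∑_{j≥1} ((1-w_j)^{1/2}/j²) g(r w_j)/g(w_j)` converges to a finite positive
number, and `F(r) → ∞` as `r → 1⁻`. -/
theorem series_diverges_at_boundary (α β : ℝ) (hα : 1 < α) (hαβ : α < β) (hβ : β < α + 1) :
    (∀ r ∈ Set.Ioo (0 : ℝ) 1,
      Summable (fun j : ℕ => Real.sqrt (1 - wseq β (j + 1)) / ((j : ℝ) + 1) ^ 2 *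
        (gfun α β (r * wseq β (j + 1)) / gfun α β (wseq β (j + 1))))) ∧
    (∀ r ∈ Set.Ioo (0 : ℝ) 1,
      0 < ∑' j : ℕ, Real.sqrt (1 - wseq β (j + 1)) / ((j : ℝ) + 1) ^ 2 *
        (gfun α β (r * wseq β (j + 1)) / gfun α β (wseq β (j + 1)))) ∧
    Tendsto (fun r : ℝ => ∑' j : ℕ, Real.sqrt (1 - wseq β (j + 1)) / ((j : ℝ) + 1) ^ 2 *
        (gfun α β (r * wseq β (j + 1)) / gfun α β (wseq β (j + 1))))
      (nhdsWithin 1 (Set.Iio 1)) atTop := by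
  have hβ0 : 0 < β := by linarith
  have ht : ∀ k, 0 < tseq (wseq β) (k + 1) := fun k =>
    tseq_pos (by linarith [half_le_wseq hβ0.le k]) (wseq_lt_one _ _)
  have he : ∀ k, 0 ≤ epsseq (wseq β) (rhoseq α) (k + 1) := fun k => epsseq_nonneg _ _ _
  have hs := summable_epsseq hα hαβ hβ
  have hpos : ∀ (r : ℝ) (j : ℕ), 0 < Real.sqrt (1 - wseq β (j + 1)) / ((j : ℝ) + 1) ^ 2 *
      (gfun α β (r * wseq β (j + 1)) / gfun α β (wseq β (j + 1))) := by
    intro r j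
    have := Real.sqrt_pos.2 (sub_pos.2 (wseq_lt_one β (j + 1)))
    simp only [gfun]
    positivity
  have hsum : ∀ r ∈ Set.Ioo (0 : ℝ) 1,
      Summable (fun j : ℕ => Real.sqrt (1 - wseq β (j + 1)) / ((j : ℝ) + 1) ^ 2 *
        (gfun α β (r * wseq β (j + 1)) / gfun α β (wseq β (j + 1)))) := by
    rintro r ⟨hr0, hr1⟩
    have hsq : Summable fun j : ℕ => 1 / ((j : ℝ) + 1) ^ 2 := by
      simpa using (summable_nat_add_iff 1).2 (Real.summable_one_div_nat_pow.2 one_lt_two)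
    refine Summable.of_nonneg_of_le (fun j => (hpos r j).le) (fun j => ?_)
      (hsq.mul_right (Real.exp (1 / Real.pi * (1 / ((1 - r) / (1 + r)) *
        ∑' k, epsseq (wseq β) (rhoseq α) (k + 1)))))
    have hw := half_le_wseq hβ0.le j
    have hw1 := wseq_lt_one β (j + 1)
    refine mul_le_mul ?_ ?_ (by simp only [gfun]; positivity) (by positivity)
    · gcongr
      exact Real.sqrt_le_one.2 (by linarith)
    · simp only [gfun]
      rw [← Real.exp_sub]
      refine Real.exp_le_exp.2 ?_
      have h1 := Ph_nonneg ht he (y := (1 - wseq β (j + 1)) / (1 + wseq β (j + 1)))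
        (div_pos (by linarith) (by linarith))
      have hru : r * wseq β (j + 1) ≤ r := by nlinarith
      have hru0 : 0 ≤ r * wseq β (j + 1) := mul_nonneg hr0.le (by linarith)
      have h2 := Ph_le ht he hs (y₀ := (1 - r) / (1 + r))
        (y := (1 - r * wseq β (j + 1)) / (1 + r * wseq β (j + 1)))
        (div_pos (by linarith) (by linarith))
        (div_le_div₀ (by linarith) (by linarith) (by linarith) (by linarith))
      linarith
  refine ⟨hsum, fun r hr => (hsum r hr).tsum_pos (fun j => (hpos r j).le) 0 (hpos r 0), ?_⟩
  rw [tendsto_atTop]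
  intro M
  have hcast : Tendsto (fun k : ℕ => (k : ℝ) + 1) atTop atTop :=
    tendsto_atTop_add_const_right _ _ tendsto_natCast_atTop_atTop
  obtain ⟨N₁, hN₁⟩ := eventually_atTop.1
    (((tendsto_exp_exp_rpow_sub_rpow hα hαβ).comp hcast).eventually_ge_atTop M)
  obtain ⟨N₂, hN₂⟩ := eventually_atTop.1
    (eventually_epsseq_succ_le hα hαβ hβ (by norm_num : (0 : ℝ) < 1 / 2000))
  set N := max N₁ N₂
  filter_upwards [Ico_mem_nhdsLT (wseq_lt_one β (N + 1))] with r hr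
  have hr0 : 0 < r := by linarith [half_le_wseq hβ0.le N, hr.1]
  have hex : ∃ m, r < wseq β (m + 1) := by
    obtain ⟨m, hm⟩ := ((tendsto_wseq hβ0).comp (tendsto_add_atTop_nat 1)
      |>.eventually_const_lt hr.2).exists
    exact ⟨m, hm⟩
  have hlt : N < Nat.find hex := by
    by_contra! hle
    have := Nat.find_spec hex
    have := monotone_wseq hβ0.le (Nat.add_le_add_right hle 1)
    linarith [hr.1]
  obtain ⟨n, hn⟩ : ∃ n, Nat.find hex = n + 1 := ⟨Nat.find hex - 1, by omega⟩
  have hnr : r ∈ Set.Icc (wseq β (n + 1)) (wseq β (n + 2)) :=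
    ⟨not_lt.1 (Nat.find_min hex (m := n) (by omega)), by
      have := Nat.find_spec hex
      rw [hn] at this
      exact this.le⟩
  have hnN₁ : N₁ ≤ n := by omega
  have hnN₂ : N₂ ≤ n := by omega
  have htail := tsum_nat_add_succ_le (u := fun k => epsseq (wseq β) (rhoseq α) (k + 1))
    (by norm_num : (0 : ℝ) ≤ 1 / 2000) (by norm_num) (n := n)
    (fun k hk => hN₂ k (hnN₂.trans hk)) hs
  have hgain := le_Ph_sub_of_mem_Icc (half_le_wseq hβ0.le) (wseq_lt_one β)
    (monotone_wseq hβ0.le) he hs (n := n) (by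
      have := he n
      norm_num at htail ⊢
      linarith) hnr
  refine (hN₁ n hnN₁).trans (le_trans ?_
    ((hsum r ⟨hr0, hr.2⟩).le_tsum n fun j _ => (hpos r j).le))
  simp only [Function.comp]
  have hsqrt : Real.sqrt (1 - wseq β (n + 1)) = Real.exp (-((n : ℝ) + 1) ^ β / 2) := by
    rw [Real.exp_half]
    simp [wseq]
  rw [hsqrt]
  simp only [gfun]
  rw [← Real.exp_sub]
  refine mul_le_mul_of_nonneg_left (Real.exp_le_exp.2 (le_trans (le_of_eq ?_) hgain))
    (by positivity)
  simp only [wseq, rhoseq, sub_sub_cancel]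
  rw [← Real.exp_sub]
  push_cast
  ring_nf
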